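/- arXiv:1912.05075 — 4 statements merged into one kernel-verified Lean document; each statement's English description precedes it below -/
import Mathlib

section
/- Let p(x,y,z) = p(z)·p(x|z)·p(y|z) with p(z) a density on Z and p(x|z), p(y|z) conditional densities; set p(x) = ∫_Z p(z)p(x|z) dμ_Z, p(y) = ∫_Z p(z)p(y|z) dμ_Z, p(x,y) = ∫_Z p(z)p(x|z)p(y|z) dμ_Z, p(z|x) = p(z)p(x|z)/p(x), p(z|y) = p(z)p(y|z)/p(y). Fix (x,y) with p(x) > 0, p(y) > 0, p(x,y) > 0, and suppose q(z|x) = p(z|x) and q(z|y) = p(z|y). Then for any conditional density q(z|x,y): E_{q(z|x)}[log(p(x|z)p(z)/q(z|x))] + E_{q(z|y)}[log(p(y|z)p(z)/q(z|y))] + E_{q(z|x,y)}[log(p(x|z)·q(z|y)/q(z|x,y))] + E_{q(z|x,y)}[log(p(y|z)·q(z|x)/q(z|x,y))] ≤ 2·log p(x,y). (Paper's Corollary 2: the four-term objective lower-bounds twice the joint log-likelihood.) -/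
open MeasureTheory

/-- **Gibbs' inequality** for an unnormalised density `r`: the evidence lower bound
`E_q[log (r / q)]` is at most the log-evidence `log ∫ r`. -/
theorem integral_mul_log_div_le_log_integral {Z : Type*} [MeasurableSpace Z] {μ : Measure Z}
    {q r : Z → ℝ} (hq_nn : ∀ z, 0 ≤ q z) (hr_nn : ∀ z, 0 ≤ r z)
    (hq_one : ∫ z, q z ∂μ = 1) (hr_pos : 0 < ∫ z, r z ∂μ)
    (hqr : ∀ z, r z = 0 → q z = 0)
    (hint : Integrable (fun z => q z * Real.log (r z / q z)) μ) :
    ∫ z, q z * Real.log (r z / q z) ∂μ ≤ Real.log (∫ z, r z ∂μ) := by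
  set c := ∫ z, r z ∂μ with hc
  have hq : Integrable q μ := .of_integral_ne_zero (by simp [hq_one])
  have hr : Integrable r μ := .of_integral_ne_zero hr_pos.ne'
  have hpt (z : Z) : q z * Real.log (r z / q z) ≤ r z / c + q z * (Real.log c - 1) := by
    rcases (hq_nn z).eq_or_lt with h0 | hqz
    · simpa [← h0] using div_nonneg (hr_nn z) hr_pos.le
    have hrz : 0 < r z := (hr_nn z).lt_of_ne fun h => hqz.ne' (hqr z h.symm)
    have hlog : Real.log (r z / q z) ≤ r z / (c * q z) - 1 + Real.log c := by
      have h := Real.log_le_sub_one_of_pos (div_pos hrz (mul_pos hr_pos hqz))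
      rw [Real.log_div hrz.ne' (mul_pos hr_pos hqz).ne', Real.log_mul hr_pos.ne' hqz.ne'] at h
      rw [Real.log_div hrz.ne' hqz.ne']
      linarith
    calc q z * Real.log (r z / q z) ≤ q z * (r z / (c * q z) - 1 + Real.log c) := by gcongr
      _ = r z / c + q z * (Real.log c - 1) := by field_simp; ring
  calc ∫ z, q z * Real.log (r z / q z) ∂μ
      ≤ ∫ z, (r z / c + q z * (Real.log c - 1)) ∂μ :=
        integral_mono hint ((hr.div_const c).add (hq.mul_const _)) hpt
    _ = Real.log c := by
        rw [integral_add (hr.div_const c) (hq.mul_const _), integral_div, integral_mul_const,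
          hq_one, ← hc, div_self hr_pos.ne']
        ring

/-- The evidence lower bound at the exact posterior is at most the log-evidence. -/
theorem integral_posterior_mul_log_le_log_evidence {Z : Type*} [MeasurableSpace Z]
    {μ : Measure Z} {p l q : Z → ℝ} {c : ℝ} (hp_nn : ∀ z, 0 ≤ p z) (hl_nn : ∀ z, 0 ≤ l z)
    (hc : c = ∫ z, p z * l z ∂μ) (hc_pos : 0 < c) (hq : ∀ z, q z = p z * l z / c)
    (hint : Integrable (fun z => q z * Real.log (l z * p z / q z)) μ) :
    ∫ z, q z * Real.log (l z * p z / q z) ∂μ ≤ Real.log c := by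
  have hlp : ∫ z, l z * p z ∂μ = c := by simp_rw [hc, mul_comm]
  rw [← hlp]
  refine integral_mul_log_div_le_log_integral (fun z => ?_)
    (fun z => mul_nonneg (hl_nn z) (hp_nn z)) ?_ (hlp ▸ hc_pos) (fun z hz => ?_) hint
  · rw [hq]
    exact div_nonneg (mul_nonneg (hp_nn z) (hl_nn z)) hc_pos.le
  · simp_rw [hq]
    rw [integral_div, ← hc, div_self hc_pos.ne']
  · rw [hq, mul_comm, hz, zero_div]

/-- Paper's Corollary 2: when the unimodal posteriors are exact, the four-term multimodal
objective lower-bounds twice the joint log-likelihood `2·log p(x,y)`. -/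
theorem four_term_objective_le_twice_joint_log_likelihood
    {X Y Z : Type*} [MeasurableSpace X] [MeasurableSpace Y] [MeasurableSpace Z]
    (μX : Measure X) (μY : Measure Y) (μZ : Measure Z)
    [SigmaFinite μX] [SigmaFinite μY] [SigmaFinite μZ]
    -- generative model p(x,y,z) = p(z) p(x|z) p(y|z)
    (pz : Z → ℝ) (pxgz : X → Z → ℝ) (pygz : Y → Z → ℝ)
    (hpz_meas : Measurable pz)
    (hpxgz_meas : Measurable fun w : X × Z => pxgz w.1 w.2)
    (hpygz_meas : Measurable fun w : Y × Z => pygz w.1 w.2)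
    (hpz_nn : ∀ z, 0 ≤ pz z) (hpxgz_nn : ∀ x z, 0 ≤ pxgz x z) (hpygz_nn : ∀ y z, 0 ≤ pygz y z)
    (hpz_one : ∫ z, pz z ∂μZ = 1)
    (hpxgz_one : ∀ z, ∫ x, pxgz x z ∂μX = 1)
    (hpygz_one : ∀ z, ∫ y, pygz y z ∂μY = 1)
    -- fix (x,y) with positive marginal and joint likelihoods
    (x : X) (y : Y) (px py pxy : ℝ)
    (hpx : px = ∫ z, pz z * pxgz x z ∂μZ)
    (hpy : py = ∫ z, pz z * pygz y z ∂μZ)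
    (hpxy : pxy = ∫ z, pz z * pxgz x z * pygz y z ∂μZ)
    (hpx_pos : 0 < px) (hpy_pos : 0 < py) (hpxy_pos : 0 < pxy)
    -- unimodal posteriors, assumed exact: q(z|x) = p(z|x), q(z|y) = p(z|y)
    (qzx qzy : Z → ℝ)
    (hqzx : ∀ z, qzx z = pz z * pxgz x z / px)
    (hqzy : ∀ z, qzy z = pz z * pygz y z / py)
    -- any conditional density q(z|x,y) (at the fixed (x,y)),
    -- vanishing wherever the corresponding integrands' numerators vanish
    (qzxy : Z → ℝ)
    (hqzxy_meas : Measurable qzxy)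
    (hqzxy_nn : ∀ z, 0 ≤ qzxy z)
    (hqzxy_one : ∫ z, qzxy z ∂μZ = 1)
    (hvanish₁ : ∀ z, pxgz x z * qzy z = 0 → qzxy z = 0)
    (hvanish₂ : ∀ z, pygz y z * qzx z = 0 → qzxy z = 0)
    -- all occurring integrals exist
    (hint₁ : Integrable (fun z => qzx z * Real.log (pxgz x z * pz z / qzx z)) μZ)
    (hint₂ : Integrable (fun z => qzy z * Real.log (pygz y z * pz z / qzy z)) μZ)
    (hint₃ : Integrable (fun z => qzxy z * Real.log (pxgz x z * qzy z / qzxy z)) μZ)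
    (hint₄ : Integrable (fun z => qzxy z * Real.log (pygz y z * qzx z / qzxy z)) μZ) :
    (∫ z, qzx z * Real.log (pxgz x z * pz z / qzx z) ∂μZ)
      + (∫ z, qzy z * Real.log (pygz y z * pz z / qzy z) ∂μZ)
      + (∫ z, qzxy z * Real.log (pxgz x z * qzy z / qzxy z) ∂μZ)
      + (∫ z, qzxy z * Real.log (pygz y z * qzx z / qzxy z) ∂μZ)
      ≤ 2 * Real.log pxy := by
  have h₁ := integral_posterior_mul_log_le_log_evidence hpz_nn (hpxgz_nn x) hpx hpx_pos hqzx hint₁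
  have h₂ := integral_posterior_mul_log_le_log_evidence hpz_nn (hpygz_nn y) hpy hpy_pos hqzy hint₂
  have hr₃ : ∫ z, pxgz x z * qzy z ∂μZ = pxy / py := by
    rw [hpxy, ← integral_div]
    congr 1 with z
    rw [hqzy]
    ring
  have hr₄ : ∫ z, pygz y z * qzx z ∂μZ = pxy / px := by
    rw [hpxy, ← integral_div]
    congr 1 with z
    rw [hqzx]
    ring
  have hqzx_nn (z : Z) : 0 ≤ qzx z :=
    hqzx z ▸ div_nonneg (mul_nonneg (hpz_nn z) (hpxgz_nn x z)) hpx_pos.le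
  have hqzy_nn (z : Z) : 0 ≤ qzy z :=
    hqzy z ▸ div_nonneg (mul_nonneg (hpz_nn z) (hpygz_nn y z)) hpy_pos.le
  have h₃ := integral_mul_log_div_le_log_integral hqzxy_nn
    (fun z => mul_nonneg (hpxgz_nn x z) (hqzy_nn z)) hqzxy_one
    (hr₃ ▸ div_pos hpxy_pos hpy_pos) hvanish₁ hint₃
  have h₄ := integral_mul_log_div_le_log_integral hqzxy_nn
    (fun z => mul_nonneg (hpygz_nn y z) (hqzx_nn z)) hqzxy_one
    (hr₄ ▸ div_pos hpxy_pos hpx_pos) hvanish₂ hint₄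
  rw [hr₃, Real.log_div hpxy_pos.ne' hpy_pos.ne'] at h₃
  rw [hr₄, Real.log_div hpxy_pos.ne' hpx_pos.ne'] at h₄
  linarith
end

section
/- Let ν be a σ-finite measure on a measurable space Ω and let q, p be probability densities with respect to ν with q = 0 ν-a.e. on {p = 0}. Then for every measurable function T: Ω → ℝ such that ∫ T·q dν and ∫ e^{T−1}·p dν exist and are finite: KL(q ‖ p) ≥ ∫ T·q dν − ∫ e^{T−1}·p dν. Consequently KL(q‖p) ≥ sup over such T of the right-hand side. (The Fenchel-dual / f-divergence variational lower bound used to define the GAN objective, Equation 2 of the paper.) -/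
open MeasureTheory

/-- KL divergence `KL(q‖p) = ∫ q·log(q/p) dν` of two densities, valued in `EReal` so that it
may equal `+∞` (namely when the defining integrand is not integrable). -/
noncomputable def klDivDensity {Ω : Type*} [MeasurableSpace Ω] (ν : Measure Ω)
    (q p : Ω → ℝ) : EReal :=
  open scoped Classical in
  if Integrable (fun ω => q ω * Real.log (q ω / p ω)) ν then
    ((∫ ω, q ω * Real.log (q ω / p ω) ∂ν : ℝ) : EReal)
  else ⊤

/-- The Fenchel–Young inequality for `x ↦ x * log x`, in perspective form. -/
theorem mul_sub_exp_mul_le_mul_log_div {q p : ℝ} (hq : 0 ≤ q) (hp : 0 ≤ p)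
    (h : p = 0 → q = 0) (t : ℝ) :
    t * q - Real.exp (t - 1) * p ≤ q * Real.log (q / p) := by
  rcases hq.eq_or_lt with rfl | hq
  · simpa using mul_nonneg (Real.exp_pos (t - 1)).le hp
  have hp : 0 < p := hp.lt_of_ne fun h0 => hq.ne' (h h0.symm)
  have hexp : Real.exp (t - 1) * p = Real.exp (t - 1 - Real.log (q / p)) * q := by
    rw [Real.exp_sub (t - 1), Real.exp_log (div_pos hq hp)]
    field_simp
  have := mul_le_mul_of_nonneg_right (Real.add_one_le_exp (t - 1 - Real.log (q / p))) hq.le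
  linarith

/-- The Fenchel-dual / f-divergence variational lower bound on the KL divergence
(Equation 2 of the paper): for every measurable `T` with `∫ T·q dν` and `∫ e^{T−1}·p dν`
finite, `KL(q‖p) ≥ ∫ T·q dν − ∫ e^{T−1}·p dν`. -/
theorem kl_ge_fenchel_dual_bound
    {Ω : Type*} [MeasurableSpace Ω] (ν : Measure Ω) [SigmaFinite ν]
    (q p : Ω → ℝ)
    (hq_meas : Measurable q) (hp_meas : Measurable p)
    (hq_nn : ∀ ω, 0 ≤ q ω) (hp_nn : ∀ ω, 0 ≤ p ω)
    (hq_int : Integrable q ν) (hp_int : Integrable p ν)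
    (hq_one : ∫ ω, q ω ∂ν = 1) (hp_one : ∫ ω, p ω ∂ν = 1)
    (habs : ∀ᵐ ω ∂ν, p ω = 0 → q ω = 0)
    (T : Ω → ℝ) (hT_meas : Measurable T)
    (hTq_int : Integrable (fun ω => T ω * q ω) ν)
    (hTp_int : Integrable (fun ω => Real.exp (T ω - 1) * p ω) ν) :
    ((∫ ω, T ω * q ω ∂ν) - ∫ ω, Real.exp (T ω - 1) * p ω ∂ν : ℝ)
      ≤ klDivDensity ν q p := by
  unfold klDivDensity
  split_ifs with hkl
  · rw [EReal.coe_le_coe_iff, ← integral_sub hTq_int hTp_int]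
    refine integral_mono_ae (hTq_int.sub hTp_int) hkl ?_
    filter_upwards [habs] with ω hω
    exact mul_sub_exp_mul_le_mul_log_div (hq_nn ω) (hp_nn ω) hω (T ω)
  · exact le_top
end

section
/- Let ν be a σ-finite measure on a measurable space Ω and let q, p be probability densities with respect to ν with q = 0 ν-a.e. on {p = 0}. Then for every measurable function T: Ω → ℝ such that ∫ T·q dν exists and 0 < ∫ e^{T}·p dν < ∞: KL(q ‖ p) ≥ ∫ T·q dν − log( ∫ e^{T}·p dν ). (Donsker–Varadhan variational lower bound on the KL divergence, the logarithmic form of the dual bound used for the multimodal discriminator.) -/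
open MeasureTheory

/-- Young-type inequality between relative entropy and the exponential, from `log x ≤ x - 1`. -/
lemma mul_sub_log_add_sub_le_mul_log_div {a b t Z : ℝ} (ha : 0 ≤ a) (hb : 0 ≤ b) (hZ : 0 < Z)
    (hab : b = 0 → a = 0) :
    t * a - Real.log Z * a + a - Real.exp t * b / Z ≤ a * Real.log (a / b) := by
  rcases ha.eq_or_lt with rfl | ha
  · have : 0 ≤ Real.exp t * b / Z := by positivity
    simpa using this
  have hb : 0 < b := hb.lt_of_ne fun h => ha.ne' (hab h.symm)
  have hlog : Real.log (Real.exp t * b / (Z * a)) = t - Real.log Z - Real.log (a / b) := by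
    rw [Real.log_div (by positivity) (by positivity), Real.log_mul (by positivity) hb.ne',
      Real.log_mul hZ.ne' ha.ne', Real.log_div ha.ne' hb.ne', Real.log_exp]
    ring
  have hle := mul_le_mul_of_nonneg_left
    (Real.log_le_sub_one_of_pos (show 0 < Real.exp t * b / (Z * a) by positivity)) ha.le
  have hcancel : a * (Real.exp t * b / (Z * a) - 1) = Real.exp t * b / Z - a := by
    field_simp
  rw [hlog, hcancel] at hle
  linarith

/-- The Donsker–Varadhan variational lower bound on the KL divergence (the logarithmic form
of the dual bound used for the multimodal discriminator): for every measurable `T` with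
`∫ T·q dν` finite and `0 < ∫ e^{T}·p dν < ∞`,
`KL(q‖p) ≥ ∫ T·q dν − log(∫ e^{T}·p dν)`. -/
theorem kl_ge_donsker_varadhan_bound
    {Ω : Type*} [MeasurableSpace Ω] (ν : Measure Ω) [SigmaFinite ν]
    (q p : Ω → ℝ)
    (hq_meas : Measurable q) (hp_meas : Measurable p)
    (hq_nn : ∀ ω, 0 ≤ q ω) (hp_nn : ∀ ω, 0 ≤ p ω)
    (hq_int : Integrable q ν) (hp_int : Integrable p ν)
    (hq_one : ∫ ω, q ω ∂ν = 1) (hp_one : ∫ ω, p ω ∂ν = 1)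
    (habs : ∀ᵐ ω ∂ν, p ω = 0 → q ω = 0)
    (T : Ω → ℝ) (hT_meas : Measurable T)
    (hTq_int : Integrable (fun ω => T ω * q ω) ν)
    (hTp_int : Integrable (fun ω => Real.exp (T ω) * p ω) ν)
    (hTp_pos : 0 < ∫ ω, Real.exp (T ω) * p ω ∂ν) :
    ((∫ ω, T ω * q ω ∂ν) - Real.log (∫ ω, Real.exp (T ω) * p ω ∂ν) : ℝ)
      ≤ klDivDensity ν q p := by
  unfold klDivDensity
  split_ifs with hKL
  swap
  · exact le_top
  rw [EReal.coe_le_coe_iff]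
  set Z := ∫ ω, Real.exp (T ω) * p ω ∂ν with hZ
  have hlogq : Integrable (fun ω => Real.log Z * q ω) ν := hq_int.const_mul _
  have hdiv : Integrable (fun ω => Real.exp (T ω) * p ω / Z) ν := hTp_int.div_const _
  have hdiff : Integrable (fun ω => T ω * q ω - Real.log Z * q ω) ν := hTq_int.sub hlogq
  have hadd : Integrable (fun ω => T ω * q ω - Real.log Z * q ω + q ω) ν := hdiff.add hq_int
  calc (∫ ω, T ω * q ω ∂ν) - Real.log Z
      = ∫ ω, (T ω * q ω - Real.log Z * q ω + q ω - Real.exp (T ω) * p ω / Z) ∂ν := by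
        rw [integral_sub hadd hdiv,
          integral_add hdiff hq_int, integral_sub hTq_int hlogq,
          integral_const_mul, integral_div, hq_one, ← hZ, div_self hTp_pos.ne']
        ring
    _ ≤ ∫ ω, q ω * Real.log (q ω / p ω) ∂ν := by
        refine integral_mono_ae (hadd.sub hdiv) hKL ?_
        filter_upwards [habs] with ω hω
        exact mul_sub_log_add_sub_le_mul_log_div (hq_nn ω) (hp_nn ω) hTp_pos hω
end

section
/- Let p(x,y,z) = p(z)·p(x|z)·p(y|z) with p(z) a density on Z and p(x|z), p(y|z) conditional densities; set p(x) = ∫_Z p(z)p(x|z) dμ_Z, p(y) = ∫_Z p(z)p(y|z) dμ_Z, p(x,y) = ∫_Z p(z)p(x|z)p(y|z) dμ_Z, p(z|x) = p(z)p(x|z)/p(x), p(z|y) = p(z)p(y|z)/p(y), p(x|y) = p(x,y)/p(y), p(y|x) = p(x,y)/p(x). Fix (x,y) with p(x), p(y), p(x,y) all positive, and suppose the unimodal posteriors are exact: q(z|x) = p(z|x) and q(z|y) = p(z|y). Then for any conditional density q(z|x,y), the JMVAE objective with weight ω = 1 satisfies: E_{q(z|x,y)}[log(p(x|z)p(y|z)p(z)/q(z|x,y))]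 − KL(q(z|x,y) ‖ q(z|x)) − KL(q(z|x,y) ‖ q(z|y)) ≤ log p(x|y) + log p(y|x). In particular the JMVAE objective bounds only the conditional log-likelihoods, not the joint log-likelihood. (Paper's bound on the JMVAE objective in Section 8.) -/
open MeasureTheory

/-- Gibbs' inequality, pointwise and unnormalised. -/
theorem mul_log_sub_log_le_sub {q r : ℝ} (hq : 0 < q) (hr : 0 < r) :
    q * (Real.log r - Real.log q) ≤ r - q := by
  have h := mul_le_mul_of_nonneg_left (Real.log_le_sub_one_of_pos (div_pos hr hq)) hq.le
  rwa [Real.log_div hr.ne' hq.ne', mul_sub_one, mul_div_cancel₀ r hq.ne'] at h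

/-- Paper's bound on the JMVAE objective (Section 8), weight ω = 1: with exact unimodal
posteriors, `ELBO(x,y) − KL(q(z|x,y)‖q(z|x)) − KL(q(z|x,y)‖q(z|y)) ≤ log p(x|y) + log p(y|x)`;
the JMVAE objective bounds only the conditional log-likelihoods. -/
theorem jmvae_objective_le_sum_of_conditional_log_likelihoods
    {X Y Z : Type*} [MeasurableSpace X] [MeasurableSpace Y] [MeasurableSpace Z]
    (μX : Measure X) (μY : Measure Y) (μZ : Measure Z)
    [SigmaFinite μX] [SigmaFinite μY] [SigmaFinite μZ]
    -- generative model p(x,y,z) = p(z) p(x|z) p(y|z)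
    (pz : Z → ℝ) (pxgz : X → Z → ℝ) (pygz : Y → Z → ℝ)
    (hpz_meas : Measurable pz)
    (hpxgz_meas : Measurable fun w : X × Z => pxgz w.1 w.2)
    (hpygz_meas : Measurable fun w : Y × Z => pygz w.1 w.2)
    (hpz_nn : ∀ z, 0 ≤ pz z) (hpxgz_nn : ∀ x z, 0 ≤ pxgz x z) (hpygz_nn : ∀ y z, 0 ≤ pygz y z)
    (hpz_one : ∫ z, pz z ∂μZ = 1)
    (hpxgz_one : ∀ z, ∫ x, pxgz x z ∂μX = 1)
    (hpygz_one : ∀ z, ∫ y, pygz y z ∂μY = 1)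
    -- fix (x,y) with positive likelihoods, marginals, conditionals
    (x : X) (y : Y) (px py pxy pxgy pygx : ℝ)
    (hpx : px = ∫ z, pz z * pxgz x z ∂μZ)
    (hpy : py = ∫ z, pz z * pygz y z ∂μZ)
    (hpxy : pxy = ∫ z, pz z * pxgz x z * pygz y z ∂μZ)
    (hpx_pos : 0 < px) (hpy_pos : 0 < py) (hpxy_pos : 0 < pxy)
    (hpxgy : pxgy = pxy / py) (hpygx : pygx = pxy / px)
    -- exact unimodal posteriors: q(z|x) = p(z|x), q(z|y) = p(z|y)
    (qzx qzy : Z → ℝ)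
    (hqzx : ∀ z, qzx z = pz z * pxgz x z / px)
    (hqzy : ∀ z, qzy z = pz z * pygz y z / py)
    -- any conditional density q(z|x,y) at the fixed (x,y),
    -- vanishing wherever the relevant numerators / reference densities vanish
    (qzxy : Z → ℝ)
    (hqzxy_meas : Measurable qzxy)
    (hqzxy_nn : ∀ z, 0 ≤ qzxy z)
    (hqzxy_one : ∫ z, qzxy z ∂μZ = 1)
    (hvanish_elbo : ∀ z, pxgz x z * pygz y z * pz z = 0 → qzxy z = 0)
    (hvanish_x : ∀ z, qzx z = 0 → qzxy z = 0)
    (hvanish_y : ∀ z, qzy z = 0 → qzxy z = 0)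
    -- all occurring integrals exist
    (hint_elbo : Integrable (fun z => qzxy z *
        Real.log (pxgz x z * pygz y z * pz z / qzxy z)) μZ)
    (hint_klx : Integrable (fun z => qzxy z * Real.log (qzxy z / qzx z)) μZ)
    (hint_kly : Integrable (fun z => qzxy z * Real.log (qzxy z / qzy z)) μZ) :
    (∫ z, qzxy z * Real.log (pxgz x z * pygz y z * pz z / qzxy z) ∂μZ)
        - (∫ z, qzxy z * Real.log (qzxy z / qzx z) ∂μZ)
        - (∫ z, qzxy z * Real.log (qzxy z / qzy z) ∂μZ)
      ≤ Real.log pxgy + Real.log pygx := by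
  have hp_int : Integrable pz μZ := .of_integral_ne_zero (by simp [hpz_one])
  have hq_int : Integrable qzxy μZ := .of_integral_ne_zero (by simp [hqzxy_one])
  have hj_int : Integrable (fun z => pz z * pxgz x z * pygz y z) μZ :=
    .of_integral_ne_zero (hpxy ▸ hpxy_pos.ne')
  set C := 2 * Real.log pxy - Real.log px - Real.log py with hC
  have hpointwise : ∀ z, qzxy z * Real.log (pxgz x z * pygz y z * pz z / qzxy z)
      - qzxy z * Real.log (qzxy z / qzx z) - qzxy z * Real.log (qzxy z / qzy z)
      ≤ (2 / pxy) * (pz z * pxgz x z * pygz y z) + pz z + (C - 3) * qzxy z := by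
    intro z
    have hp := hpz_nn z
    have ha := hpxgz_nn x z
    have hb := hpygz_nn y z
    rcases (hqzxy_nn z).eq_or_lt with hq | hq
    · rw [← hq]
      simp only [zero_mul, sub_zero, mul_zero, add_zero]
      positivity
    · have hne : pxgz x z * pygz y z * pz z ≠ 0 := fun h => hq.ne' (hvanish_elbo z h)
      have hp' : 0 < pz z := hp.lt_of_ne' (right_ne_zero_of_mul hne)
      have ha' : 0 < pxgz x z := ha.lt_of_ne' (left_ne_zero_of_mul (left_ne_zero_of_mul hne))
      have hb' : 0 < pygz y z := hb.lt_of_ne' (right_ne_zero_of_mul (left_ne_zero_of_mul hne))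
      have hjoint := mul_log_sub_log_le_sub hq
        (show 0 < pz z * pxgz x z * pygz y z / pxy by positivity)
      have hprior := mul_log_sub_log_le_sub hq hp'
      rw [Real.log_div (by positivity) hpxy_pos.ne', Real.log_mul (by positivity) hb'.ne',
        Real.log_mul hp'.ne' ha'.ne'] at hjoint
      rw [hqzx, hqzy, Real.log_div hne hq.ne', Real.log_div hq.ne' (by positivity),
        Real.log_div hq.ne' (by positivity), Real.log_div (by positivity) hpx_pos.ne',
        Real.log_div (by positivity) hpy_pos.ne', Real.log_mul (by positivity) hp'.ne',
        Real.log_mul ha'.ne' hb'.ne', Real.log_mul hp'.ne' ha'.ne',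
        Real.log_mul hp'.ne' hb'.ne', hC]
      linear_combination 2 * hjoint + hprior
  rw [← integral_sub' hint_elbo hint_klx, ← integral_sub' (hint_elbo.sub hint_klx) hint_kly]
  refine (integral_mono ((hint_elbo.sub hint_klx).sub hint_kly)
    (((hj_int.const_mul (2 / pxy)).add hp_int).add (hq_int.const_mul (C - 3)))
    hpointwise).trans_eq ?_
  rw [integral_add' ((hj_int.const_mul _).add hp_int) (hq_int.const_mul _),
    integral_add' (hj_int.const_mul _) hp_int, integral_const_mul, integral_const_mul,
    ← hpxy, hpz_one, hqzxy_one, hpxgy, hpygx, Real.log_div hpxy_pos.ne' hpy_pos.ne',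
    Real.log_div hpxy_pos.ne' hpx_pos.ne', div_mul_cancel₀ _ hpxy_pos.ne', hC]
  ring
end
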